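/- ($q$-Pfaff–Saalschütz summation, symmetric form.) For all non-negative integers $A, B, C, D$, one has $\sum_{k \geq 0} \frac{[A+B+C+D-k]_q!}{[k]_q!\,[A-k]_q!\,[B-k]_q!\,[C-k]_q!\,[D+k]_q!} = \genfrac{[}{]}{0pt}{}{A+B+D}{B}_q \genfrac{[}{]}{0pt}{}{A+C+D}{A}_q \genfrac{[}{]}{0pt}{}{B+C+D}{C}_q$, where the sum ranges over $0 \leq k \leq \min(A,B,C)$. -/

import Mathlib

noncomputable def qint (t : RatFunc ℚ) (n : ℤ) : RatFunc ℚ := t ^ n - t ^ (-n)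

noncomputable def qfact (t : RatFunc ℚ) (n : ℤ) : RatFunc ℚ :=
  ∏ i ∈ Finset.range n.toNat, qint t ((i : ℤ) + 1)

/-- The symmetric `q`-binomial coefficient `[n m]_q`, with `t = q^{1/2}`. -/
noncomputable def qbinom (t : RatFunc ℚ) (n m : ℤ) : RatFunc ℚ :=
  if 0 ≤ m ∧ m ≤ n then qfact t n / (qfact t m * qfact t (n - m)) else 0

theorem qint_zero (t : RatFunc ℚ) : qint t 0 = 0 := by
  simp [qint]

theorem qint_X_ne_zero {n : ℤ} (hn : 0 < n) : qint RatFunc.X n ≠ 0 := by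
  lift n to ℕ using hn.le
  intro h
  rw [qint, sub_eq_zero, zpow_neg, zpow_natCast, ← one_mul (RatFunc.X ^ n)⁻¹,
    eq_mul_inv_iff_mul_eq₀ (pow_ne_zero _ RatFunc.X_ne_zero), ← pow_add] at h
  have hX : (Polynomial.X : Polynomial ℚ) ^ (n + n) = 1 := by
    apply RatFunc.algebraMap_injective ℚ
    simpa using h
  have hdeg := congrArg Polynomial.natDegree hX
  simp at hdeg
  omega

theorem qfact_zero (t : RatFunc ℚ) : qfact t 0 = 1 := by
  simp [qfact]

theorem qfact_add_one (t : RatFunc ℚ) {n : ℤ} (hn : 0 ≤ n) :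
    qfact t (n + 1) = qint t (n + 1) * qfact t n := by
  lift n to ℕ using hn
  have h : ((n : ℤ) + 1).toNat = n + 1 := by omega
  rw [qfact, h, Finset.prod_range_succ, mul_comm, qfact, Int.toNat_natCast]

theorem qfact_X_ne_zero (n : ℤ) : qfact RatFunc.X n ≠ 0 :=
  Finset.prod_ne_zero_iff.mpr fun _ _ => qint_X_ne_zero (by omega)

/-- The reciprocal of the `q`-factorial, extended by zero to negative integers. -/
noncomputable def qfactInv (t : RatFunc ℚ) (n : ℤ) : RatFunc ℚ :=
  if 0 ≤ n then (qfact t n)⁻¹ else 0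

theorem qfactInv_of_nonneg (t : RatFunc ℚ) {n : ℤ} (hn : 0 ≤ n) :
    qfactInv t n = (qfact t n)⁻¹ :=
  if_pos hn

theorem qfactInv_of_neg (t : RatFunc ℚ) {n : ℤ} (hn : n < 0) : qfactInv t n = 0 :=
  if_neg hn.not_ge

theorem qfactInv_X_sub_one (n : ℤ) :
    qfactInv RatFunc.X (n - 1) = qint RatFunc.X n * qfactInv RatFunc.X n := by
  rcases lt_trichotomy n 0 with hn | rfl | hn
  · rw [qfactInv_of_neg _ hn, qfactInv_of_neg _ (by omega), mul_zero]
  · rw [qint_zero, qfactInv_of_neg _ (by omega), zero_mul]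
  · have h := qfact_add_one RatFunc.X (n := n - 1) (by omega)
    rw [sub_add_cancel] at h
    rw [qfactInv_of_nonneg _ (by omega), qfactInv_of_nonneg _ hn.le, h, mul_inv,
      mul_inv_cancel_left₀ (qint_X_ne_zero hn)]

/-- The summand of the `q`-Pfaff–Saalschütz sum, extended by zero to all integers `k` for which
one of the factorials in the denominator has a negative argument. -/
noncomputable def saalschutzTerm (t : RatFunc ℚ) (A B C D k : ℤ) : RatFunc ℚ :=
  qfact t (A + B + C + D - k) * qfactInv t k * qfactInv t (A - k) * qfactInv t (B - k) *
    qfactInv t (C - k) * qfactInv t (D + k)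

/-- The companion of `saalschutzTerm` in the telescoping relation in the parameter `A`. -/
noncomputable def saalschutzCompanion (t : RatFunc ℚ) (A B C D k : ℤ) : RatFunc ℚ :=
  qfact t (A + B + C + D + 1 - k) * qfactInv t (k - 1) * qfactInv t (A + 1 - k) *
    qfactInv t (B - k) * qfactInv t (C - k) * qfactInv t (D + k - 1)

theorem qint_saalschutz_identity {t : RatFunc ℚ} (ht : t ≠ 0) (A B C D k : ℤ) :
    qint t (A + 1) * qint t (A + D + 1) * qint t (A + B + C + D + 1 - k) -
        qint t (A + B + D + 1) * qint t (A + C + D + 1) * qint t (A + 1 - k) =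
      qint t (A + B + C + D + 1 - k) * qint t k * qint t (D + k) -
        qint t (A + 1 - k) * qint t (B - k) * qint t (C - k) := by
  simp only [qint, zpow_neg, zpow_add₀ ht, zpow_sub₀ ht, zpow_one]
  have hA := zpow_ne_zero A ht
  have hB := zpow_ne_zero B ht
  have hC := zpow_ne_zero C ht
  have hD := zpow_ne_zero D ht
  have hk := zpow_ne_zero k ht
  generalize t ^ A = a at *
  generalize t ^ B = b at *
  generalize t ^ C = c at *
  generalize t ^ D = d at *
  generalize t ^ k = x at *
  field_simp
  ring

theorem saalschutzTerm_telescoping {A B C D k : ℤ} (hk : k ≤ A + B + C + D) :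
    qint RatFunc.X (A + 1) * qint RatFunc.X (A + D + 1) *
          saalschutzTerm RatFunc.X (A + 1) B C D k -
        qint RatFunc.X (A + B + D + 1) * qint RatFunc.X (A + C + D + 1) *
          saalschutzTerm RatFunc.X A B C D k =
      saalschutzCompanion RatFunc.X A B C D k -
        saalschutzCompanion RatFunc.X A B C D (k + 1) := by
  have hN := qfact_add_one RatFunc.X (n := A + B + C + D - k) (by omega)
  have hA := qfactInv_X_sub_one (A + 1 - k)
  have hB := qfactInv_X_sub_one (B - k)
  have hC := qfactInv_X_sub_one (C - k)
  have hD := qfactInv_X_sub_one (D + k)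
  have hK := qfactInv_X_sub_one k
  have hid := qint_saalschutz_identity RatFunc.X_ne_zero A B C D k
  rw [show A + B + C + D - k + 1 = A + B + C + D + 1 - k by ring] at hN
  rw [show A + 1 - k - 1 = A - k by ring] at hA
  simp only [saalschutzTerm, saalschutzCompanion,
    show A + 1 + B + C + D - k = A + B + C + D + 1 - k by ring,
    show A + B + C + D + 1 - (k + 1) = A + B + C + D - k by ring,
    show A + 1 - (k + 1) = A - k by ring, show B - (k + 1) = B - k - 1 by ring,
    show C - (k + 1) = C - k - 1 by ring, show D + (k + 1) - 1 = D + k by ring,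
    show k + 1 - 1 = k by ring, hN, hA, hB, hC, hD, hK]
  linear_combination (qfact RatFunc.X (A + B + C + D - k) * qfactInv RatFunc.X k *
    qfactInv RatFunc.X (A + 1 - k) * qfactInv RatFunc.X (B - k) *
    qfactInv RatFunc.X (C - k) * qfactInv RatFunc.X (D + k)) * hid

theorem sum_saalschutzTerm_succ (A B C D : ℕ) :
    qint RatFunc.X (A + 1) * qint RatFunc.X (A + D + 1) *
        ∑ k ∈ Finset.range (B + 1), saalschutzTerm RatFunc.X (A + 1) B C D k =
      qint RatFunc.X (A + B + D + 1) * qint RatFunc.X (A + C + D + 1) *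
        ∑ k ∈ Finset.range (B + 1), saalschutzTerm RatFunc.X A B C D k := by
  rw [← sub_eq_zero, Finset.mul_sum, Finset.mul_sum, ← Finset.sum_sub_distrib]
  calc
    _ = ∑ k ∈ Finset.range (B + 1), (saalschutzCompanion RatFunc.X A B C D (k : ℕ) -
          saalschutzCompanion RatFunc.X A B C D ((k + 1 : ℕ) : ℤ)) := by
      refine Finset.sum_congr rfl fun k hk => ?_
      rw [Finset.mem_range] at hk
      rw [Nat.cast_succ]
      exact saalschutzTerm_telescoping (by omega)
    _ = 0 := by
      rw [Finset.sum_range_sub' fun k : ℕ => saalschutzCompanion RatFunc.X A B C D k]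
      simp [saalschutzCompanion, qfactInv_of_neg]

theorem qbinom_add_eq (t : RatFunc ℚ) (m n : ℕ) :
    qbinom t ((m : ℤ) + n) n = qfact t (m + n) / (qfact t n * qfact t m) := by
  rw [qbinom, if_pos (by omega), add_sub_cancel_right]

theorem sum_saalschutzTerm (A B C D : ℕ) :
    ∑ k ∈ Finset.range (B + 1), saalschutzTerm RatFunc.X A B C D k =
      qfact RatFunc.X (A + B + D) * qfact RatFunc.X (A + C + D) * qfact RatFunc.X (B + C + D) /
        (qfact RatFunc.X B * qfact RatFunc.X (A + D) * qfact RatFunc.X A *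
          qfact RatFunc.X (C + D) * qfact RatFunc.X C * qfact RatFunc.X (B + D)) := by
  induction A with
  | zero =>
    rw [Finset.sum_eq_single_of_mem 0 (by simp)]
    · have hBD := qfact_X_ne_zero (B + D)
      have hCD := qfact_X_ne_zero (C + D)
      simp only [saalschutzTerm, Nat.cast_zero, zero_add, sub_zero, add_zero,
        qfactInv_of_nonneg _ le_rfl, qfactInv_of_nonneg _ (Int.natCast_nonneg _), qfact_zero]
      field_simp
    · intro k _ hk
      simp [saalschutzTerm, qfactInv_of_neg RatFunc.X (n := -(k : ℤ)) (by omega)]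
  | succ A ih =>
    have h := sum_saalschutzTerm_succ A B C D
    have hA : qint RatFunc.X ((A : ℤ) + 1) ≠ 0 := qint_X_ne_zero (by omega)
    have hAD : qint RatFunc.X ((A : ℤ) + D + 1) ≠ 0 := qint_X_ne_zero (by omega)
    rw [ih] at h
    apply mul_left_cancel₀ (mul_ne_zero hA hAD)
    rw [Nat.cast_succ, h, show (A : ℤ) + 1 + B + D = A + B + D + 1 by ring,
      show (A : ℤ) + 1 + C + D = A + C + D + 1 by ring,
      show (A : ℤ) + 1 + D = A + D + 1 by ring,
      qfact_add_one _ (by omega : (0 : ℤ) ≤ A), qfact_add_one _ (by omega : (0 : ℤ) ≤ A + D),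
      qfact_add_one _ (by omega : (0 : ℤ) ≤ A + B + D),
      qfact_add_one _ (by omega : (0 : ℤ) ≤ A + C + D)]
    have h1 := qfact_X_ne_zero A
    have h2 := qfact_X_ne_zero (A + D)
    field_simp

theorem stmt1 (A B C D : ℕ) :
    (∑ k ∈ Finset.range (Nat.min A (Nat.min B C) + 1),
        qfact RatFunc.X ((A : ℤ) + B + C + D - k) /
          (qfact RatFunc.X (k : ℤ) * qfact RatFunc.X ((A : ℤ) - k) *
           qfact RatFunc.X ((B : ℤ) - k) * qfact RatFunc.X ((C : ℤ) - k) *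
           qfact RatFunc.X ((D : ℤ) + k))) =
      qbinom RatFunc.X ((A : ℤ) + B + D) (B : ℤ) *
      qbinom RatFunc.X ((A : ℤ) + C + D) (A : ℤ) *
      qbinom RatFunc.X ((B : ℤ) + C + D) (C : ℤ) := by
  rw [show Nat.min A (Nat.min B C) = min A (min B C) from rfl]
  have hsum : ∑ k ∈ Finset.range (min A (min B C) + 1),
      saalschutzTerm RatFunc.X A B C D k =
        ∑ k ∈ Finset.range (B + 1), saalschutzTerm RatFunc.X A B C D k := by
    apply Finset.sum_subset
    · intro k hk
      simp only [Finset.mem_range] at hk ⊢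
      omega
    · intro k _ hk
      have hk' : (A : ℤ) - k < 0 ∨ (B : ℤ) - k < 0 ∨ (C : ℤ) - k < 0 := by
        simp only [Finset.mem_range] at hk
        omega
      rcases hk' with h | h | h <;> simp [saalschutzTerm, qfactInv_of_neg _ h]
  rw [show (A : ℤ) + B + D = (A + D : ℕ) + B by push_cast; ring,
    show (A : ℤ) + C + D = (C + D : ℕ) + A by push_cast; ring,
    show (B : ℤ) + C + D = (B + D : ℕ) + C by push_cast; ring,
    qbinom_add_eq, qbinom_add_eq, qbinom_add_eq]
  calc
    _ = ∑ k ∈ Finset.range (min A (min B C) + 1),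
          saalschutzTerm RatFunc.X A B C D k := by
      refine Finset.sum_congr rfl fun k hk => ?_
      have hk' : 0 ≤ (A : ℤ) - k ∧ 0 ≤ (B : ℤ) - k ∧ 0 ≤ (C : ℤ) - k := by
        simp only [Finset.mem_range] at hk
        omega
      rw [saalschutzTerm, qfactInv_of_nonneg _ hk'.1, qfactInv_of_nonneg _ hk'.2.1,
        qfactInv_of_nonneg _ hk'.2.2, qfactInv_of_nonneg _ (by omega : (0 : ℤ) ≤ k),
        qfactInv_of_nonneg _ (by omega : (0 : ℤ) ≤ D + k)]
      simp only [div_eq_mul_inv, mul_inv, mul_assoc]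
    _ = _ := by
      rw [hsum, sum_saalschutzTerm]
      push_cast
      rw [show (A : ℤ) + D + B = A + B + D by ring, show (C : ℤ) + D + A = A + C + D by ring,
        show (B : ℤ) + D + C = B + C + D by ring, div_mul_div_comm, div_mul_div_comm]
      congr 1
      ring
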